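/- Let n ≥ 1, ε ∈ [0, 1/2], and b ∈ {0,1}ⁿ. Let μ be a probability measure on {0,1}ⁿ (the joint distribution of bits C₁, …, Cₙ) such that for every i ∈ {1,…,n}, every prefix x ∈ {0,1}^{i−1} with μ[C₁ = x₁, …, C_{i−1} = x_{i−1}] > 0, and every value c ∈ {0,1}: Pr[Cᵢ = c | C₁ = x₁, …, C_{i−1} = x_{i−1}] ≤ 1/2 + ε. Let a′₁ < … < a′_{m′} enumerate the set {i : bᵢ = 0}. Then Pr[∃ k ∈ {1,…,m′} : Cⱼ = bⱼ for all j < a′_k and C_{a′_k} = 1] ≤ Σ_{k=1}^{m′} (1/2 + ε)^{a′_k − k + 1} (1/2 − ε)^{k − 1}. -/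

import Mathlib

/-- The probability of an event `A ⊆ {0,1}ⁿ` under the distribution with mass
function `p`. -/
noncomputable def prOf {n : ℕ} (p : (Fin n → Bool) → ℝ) (A : Set (Fin n → Bool)) : ℝ :=
  ∑ c : Fin n → Bool, A.indicator p c

open Finset in
/-- The claimed bound for the play on the positions `i, …, n - 1`, where `β j` is the bit
announced at position `j`: position `l` with `β l = false` contributes `A` times the weights
(`A` for a one, `B` for a zero) of the positions in `[i, l)`. -/
noncomputable def suffixBound (A B : ℝ) (β : ℕ → Bool) (n i : ℕ) : ℝ :=
  ∑ l ∈ Ico i n, if β l = false then A * ∏ j ∈ Ico i l, (if β j then A else B) else 0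

theorem suffixBound_eq {A B : ℝ} {β : ℕ → Bool} {n i : ℕ} (hi : i < n) :
    suffixBound A B β n i =
      (if β i then A else B) * suffixBound A B β n (i + 1) + (if β i then 0 else A) := by
  unfold suffixBound
  rw [Finset.sum_eq_sum_Ico_succ_bot hi, Finset.mul_sum, add_comm]
  congr 1
  · refine Finset.sum_congr rfl fun l hl => ?_
    rw [Finset.prod_eq_prod_Ico_succ_bot (Finset.mem_Ico.1 hl).1]
    split_ifs <;> ring
  · cases h : β i <;> simp

theorem suffixBound_self {A B : ℝ} {β : ℕ → Bool} {n : ℕ} : suffixBound A B β n n = 0 := by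
  simp [suffixBound]

theorem suffixBound_mem_Icc {A B : ℝ} (hA : 0 ≤ A) (hB : 0 ≤ B) (hAB : A + B = 1)
    {β : ℕ → Bool} {n i : ℕ} (hi : i ≤ n) :
    suffixBound A B β n i ∈ Set.Icc 0 1 := by
  induction hi using Nat.decreasingInduction with
  | self => simp [suffixBound_self]
  | of_succ k hk ih =>
    obtain ⟨h0, h1⟩ := ih
    rw [suffixBound_eq hk]
    cases β k <;> constructor <;> simp <;> nlinarith

/-- A process that is still running at time `i` with probability `P i`, and is won at a time
`≥ i` with probability `F i`, is won at a time `≥ i` with probability at most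
`P i * suffixBound A B β n i`. -/
theorem le_mul_suffixBound {A B : ℝ} (hA : 0 ≤ A) (hB : 0 ≤ B) (hAB : A + B = 1)
    {β : ℕ → Bool} {n : ℕ} {P F : ℕ → ℝ} (hFn : F n = 0)
    (hF : ∀ i < n, F i = F (i + 1) + if β i then 0 else P i - P (i + 1))
    (hP : ∀ i < n, P (i + 1) ≤ A * P i) (hP' : ∀ i < n, P i - P (i + 1) ≤ A * P i)
    {i : ℕ} (hi : i ≤ n) : F i ≤ P i * suffixBound A B β n i := by
  induction hi using Nat.decreasingInduction with
  | self => simp [suffixBound_self, hFn]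
  | of_succ k hk ih =>
    obtain ⟨h0, h1⟩ := suffixBound_mem_Icc hA hB hAB (β := β) (Nat.succ_le_of_lt hk)
    rw [suffixBound_eq hk, hF k hk]
    have hPk := hP k hk
    have hPk' := hP' k hk
    simp only [Nat.succ_eq_add_one] at h0 h1
    obtain rfl : B = 1 - A := by linarith
    cases β k <;> simp <;> nlinarith

theorem prOf_union {n : ℕ} (p : (Fin n → Bool) → ℝ) {S T : Set (Fin n → Bool)}
    (h : Disjoint S T) : prOf p (S ∪ T) = prOf p S + prOf p T := by
  simp [prOf, Set.indicator_union_of_disjoint h, Finset.sum_add_distrib]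

theorem prOf_nonneg {n : ℕ} {p : (Fin n → Bool) → ℝ} (hp0 : ∀ c, 0 ≤ p c)
    (S : Set (Fin n → Bool)) : 0 ≤ prOf p S :=
  Finset.sum_nonneg fun _ _ => Set.indicator_nonneg (fun _ _ => hp0 _) _

theorem prOf_mono {n : ℕ} {p : (Fin n → Bool) → ℝ} (hp0 : ∀ c, 0 ≤ p c)
    {S T : Set (Fin n → Bool)} (h : S ⊆ T) : prOf p S ≤ prOf p T :=
  Finset.sum_le_sum fun _ _ => Set.indicator_le_indicator_of_subset h hp0 _

theorem prOf_univ {n : ℕ} (p : (Fin n → Bool) → ℝ) : prOf p Set.univ = ∑ c, p c := by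
  simp [prOf]

theorem card_filter_lt_orderIsoOfFin {α : Type*} [LinearOrder α] (s : Finset α)
    (k : Fin s.card) : (s.filter (· < (s.orderIsoOfFin rfl k : α))).card = k := by
  have h : s.filter (· < (s.orderIsoOfFin rfl k : α)) =
      (Finset.Iio k).map (s.orderEmbOfFin rfl).toEmbedding := by
    ext a
    rw [Finset.mem_filter]
    simp only [Finset.mem_map, Finset.mem_Iio,
      RelEmbedding.coe_toEmbedding, Finset.coe_orderIsoOfFin_apply]
    constructor
    · rintro ⟨ha, hlt⟩
      obtain ⟨j, rfl⟩ : a ∈ Set.range (s.orderEmbOfFin rfl) := by simpa using ha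
      exact ⟨j, (s.orderEmbOfFin rfl).lt_iff_lt.1 hlt, rfl⟩
    · rintro ⟨j, hj, rfl⟩
      exact ⟨s.orderEmbOfFin_mem rfl j, (s.orderEmbOfFin rfl).lt_iff_lt.2 hj⟩
  rw [h, Finset.card_map, Fin.card_Iio]

theorem prod_ite_Iio_orderIsoOfFin {n : ℕ} (A B : ℝ) (b : Fin n → Bool)
    (k : Fin (Finset.univ.filter fun i => b i = false).card) :
    ∏ j ∈ Finset.Iio ((Finset.univ.filter fun i => b i = false).orderIsoOfFin rfl k : Fin n),
        (if b j then A else B) =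
      A ^ ((((Finset.univ.filter fun i => b i = false).orderIsoOfFin rfl k : Fin n) : ℕ)
        - (k : ℕ)) * B ^ (k : ℕ) := by
  have hk := card_filter_lt_orderIsoOfFin (Finset.univ.filter fun i => b i = false) k
  set a : Fin n := ((Finset.univ.filter fun i => b i = false).orderIsoOfFin rfl k).val
  have hzero : ((Finset.Iio a).filter fun j => ¬ b j = true).card = k := by
    rw [← hk]
    congr 1
    ext j
    simp [and_comm]
  have hone : ((Finset.Iio a).filter fun j => b j = true).card = a - k := by
    have := Finset.card_filter_add_card_filter_not (s := Finset.Iio a) (fun j => b j = true)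
    rw [hzero, Fin.card_Iio] at this
    omega
  rw [Finset.prod_ite, Finset.prod_const, Finset.prod_const, hzero, hone]

theorem suffixBound_zero_eq_sum {n : ℕ} (A B : ℝ) (b : Fin n → Bool) {β : ℕ → Bool}
    (hβ : ∀ j : Fin n, β j = b j) :
    suffixBound A B β n 0 =
      ∑ k : Fin (Finset.univ.filter fun i => b i = false).card,
        A ^ ((((Finset.univ.filter fun i => b i = false).orderIsoOfFin rfl k : Fin n) : ℕ)
          - (k : ℕ) + 1) * B ^ (k : ℕ) := by
  have hprod (i : Fin n) : ∏ j ∈ Finset.Ico 0 (i : ℕ), (if β j then A else B) =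
      ∏ j ∈ Finset.Iio i, (if b j then A else B) := by
    have : Finset.Ico 0 (i : ℕ) = (Finset.Iio i).map Fin.valEmbedding := by
      rw [Fin.map_valEmbedding_Iio, Nat.Iio_eq_range, Finset.range_eq_Ico]
    rw [this, Finset.prod_map]
    simp [hβ]
  unfold suffixBound
  rw [← Finset.range_eq_Ico, ← Fin.sum_univ_eq_sum_range
    (fun l => if β l = false then A * ∏ j ∈ Finset.Ico 0 l, (if β j then A else B) else 0)]
  simp only [hβ, hprod]
  rw [← Finset.sum_filter, ← Finset.sum_coe_sort,
    ← Equiv.sum_comp ((Finset.univ.filter fun i => b i = false).orderIsoOfFin rfl).toEquiv]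
  refine Finset.sum_congr rfl fun k _ => ?_
  have := prod_ite_Iio_orderIsoOfFin A B b k
  simp only [RelIso.coe_fn_toEquiv]
  rw [this, pow_succ]
  ring

/-- Let `μ` (mass function `p`) be a joint distribution of bits `C₁, …, Cₙ` such that
every conditional bit, given any positive-probability prefix, takes each value with
probability at most `1/2 + ε`.  Let `a₁ < … < a_m` enumerate the zero-positions of
`b`.  Then the probability that the bit string first deviates from `b` at a
zero-position `a_k`, taking value `1` there, is at most
`Σ_{k=1}^m (1/2 + ε)^{a_k − k + 1} (1/2 − ε)^{k − 1}`.
(Here positions are 0-based: `a_k = position + 1`, `k = index + 1`, so the exponents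
are `position − index + 1` and `index`.) -/
theorem bob_win_prob_le (n : ℕ) (hn : 1 ≤ n) (ε : ℝ) (hε0 : 0 ≤ ε) (hε : ε ≤ 1 / 2)
    (b : Fin n → Bool) (p : (Fin n → Bool) → ℝ)
    (hp0 : ∀ c, 0 ≤ p c) (hp1 : ∑ c, p c = 1)
    (hcond : ∀ (i : Fin n) (x : Fin n → Bool) (v : Bool),
      0 < prOf p {c | ∀ j, j < i → c j = x j} →
      prOf p {c | c i = v ∧ ∀ j, j < i → c j = x j} /
        prOf p {c | ∀ j, j < i → c j = x j} ≤ 1 / 2 + ε) :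
    prOf p {c | ∃ i, b i = false ∧ c i = true ∧ ∀ j, j < i → c j = b j}
      ≤ ∑ k : Fin (Finset.univ.filter fun i => b i = false).card,
          (1 / 2 + ε) ^
            ((((Finset.univ.filter fun i => b i = false).orderIsoOfFin rfl k : Fin n) : ℕ)
              - (k : ℕ) + 1)
          * (1 / 2 - ε) ^ (k : ℕ) := by
  let β : ℕ → Bool := fun j => if h : j < n then b ⟨j, h⟩ else true
  have hβ (j : Fin n) : β j = b j := by simp [β]
  let pre : ℕ → Set (Fin n → Bool) := fun i => {c | ∀ j : Fin n, (j : ℕ) < i → c j = b j}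
  let win : ℕ → Set (Fin n → Bool) := fun i =>
    {c | ∃ l : Fin n, i ≤ l ∧ b l = false ∧ c l = true ∧ ∀ j, j < l → c j = b j}
  have hbit (i : Fin n) (v : Bool) :
      prOf p {c | c i = v ∧ ∀ j, j < i → c j = b j} ≤ (1 / 2 + ε) * prOf p (pre i) := by
    rcases (prOf_nonneg hp0 (pre i)).eq_or_lt with h | h
    · rw [← h, mul_zero, h]
      exact prOf_mono hp0 fun c hc => hc.2
    · exact (div_le_iff₀ h).1 (hcond i b v h)
  have hsucc (i : Fin n) : pre (i + 1) = {c | c i = b i ∧ ∀ j, j < i → c j = b j} := by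
    ext c
    refine ⟨fun h => ⟨h i (Nat.lt_succ_self _), fun j hj => h j (Nat.lt_succ_of_lt hj)⟩,
      fun h j hj => ?_⟩
    rcases (Nat.lt_succ_iff.1 hj).eq_or_lt with e | e
    · rw [Fin.ext e, h.1]
    · exact h.2 j e
  have hsplit (i : Fin n) : prOf p {c | c i = !b i ∧ ∀ j, j < i → c j = b j} =
      prOf p (pre i) - prOf p (pre (i + 1)) := by
    rw [eq_sub_iff_add_eq, hsucc, ← prOf_union]
    · congr 1
      ext c
      simp only [pre, Set.mem_union, Set.mem_ofPred_eq, ← or_and_right, Fin.lt_def]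
      cases c i <;> cases b i <;> simp
    · rw [Set.disjoint_left]
      rintro c ⟨h, -⟩ ⟨h', -⟩
      simp [h'] at h
  have hwin (i : Fin n) : prOf p (win i) = prOf p (win (i + 1)) +
      if b i then 0 else prOf p (pre i) - prOf p (pre (i + 1)) := by
    have hstep (c : Fin n → Bool) : c ∈ win i ↔
        c ∈ win (i + 1) ∨ b i = false ∧ c i = true ∧ ∀ j, j < i → c j = b j := by
      constructor
      · rintro ⟨l, hl, h⟩
        rcases hl.eq_or_lt with e | e
        · obtain rfl := Fin.ext e
          exact Or.inr h
        · exact Or.inl ⟨l, e, h⟩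
      · rintro (⟨l, hl, h⟩ | h)
        · exact ⟨l, Nat.le_of_succ_le hl, h⟩
        · exact ⟨i, le_rfl, h⟩
    cases hb : b i
    · rw [← hsplit, hb, if_neg Bool.false_ne_true, ← prOf_union]
      · congr 1
        ext c
        simp [hstep, hb]
      · rw [Set.disjoint_left]
        rintro c ⟨l, hl, -, -, h⟩ ⟨h', -⟩
        have := h i hl
        simp [h', hb] at this
    · rw [if_pos rfl, add_zero]
      congr 1
      ext c
      simp [hstep, hb]
  have hmain := le_mul_suffixBound (A := 1 / 2 + ε) (B := 1 / 2 - ε) (β := β) (n := n)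
    (P := fun i => prOf p (pre i)) (F := fun i => prOf p (win i))
    (by linarith) (by linarith) (by ring) ?_ ?_ ?_ ?_ (Nat.zero_le n)
  · have hpre : pre 0 = Set.univ := by simp [pre]
    have hwin0 : win 0 = {c | ∃ i, b i = false ∧ c i = true ∧ ∀ j, j < i → c j = b j} := by
      simp [win]
    rwa [hpre, prOf_univ, hp1, one_mul, hwin0, suffixBound_zero_eq_sum _ _ b hβ] at hmain
  · have : win n = ∅ := by
      ext c
      simp [win]
    simp [this, prOf]
  · intro i hi
    simpa [← hβ] using hwin ⟨i, hi⟩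
  · intro i hi
    simpa only [← hsucc] using hbit ⟨i, hi⟩ (b ⟨i, hi⟩)
  · intro i hi
    simpa only [hsplit] using hbit ⟨i, hi⟩ (!b ⟨i, hi⟩)
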